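/- Let I = {c_1,...,c_n} be a 3SAT instance, where each clause c_i = {l_{i,1}, l_{i,2}, l_{i,3}} consists of literals over a set of atoms A. Introduce fresh atoms k_1,...,k_n (one per clause) and a fresh atom s, and define the rule base B_I with facts F(B_I) = {a, ¬a : a ∈ A} ∪ {¬s} and rules R(B_I) = {l_{i,j} → k_i : j = 1,2,3, i = 1,...,n} ∪ {r}, where r is the rule k_1,...,k_n → s. Then I is satisfiable (there is a truth assignment on A satisfying every clause) if and only if there exists a minimal inconsistent subset M ∈ MI(B_I) with r ∈ M. -/

import Mathlib

open scoped Classical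

/-- A literal over a set of atoms `A`: an atom or its negation. -/
inductive Literal (A : Type) where
  | pos (a : A)
  | neg (a : A)
deriving DecidableEq

/-- A business rule `l₁,...,lₘ → l₀`: a finite body of literals and a head literal.
A rule with empty body is a fact. -/
structure Rule (A : Type) where
  body : Finset (Literal A)
  head : Literal A

instance {A : Type} [DecidableEq A] : DecidableEq (Rule A) :=
  fun r s => decidable_of_iff (r.body = s.body ∧ r.head = s.head)
    (by cases r; cases s; simp)

/-- A set of literals `M` is closed w.r.t. a rule base `B` if for every rule of `B`
whose body is contained in `M`, its head is in `M`. -/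
def LitsClosed {A : Type} (B : Finset (Rule A)) (M : Set (Literal A)) : Prop :=
  ∀ r ∈ B, (∀ l ∈ r.body, l ∈ M) → r.head ∈ M

/-- The minimal model of a rule base: the smallest closed set of literals. -/
def minModel {A : Type} (B : Finset (Rule A)) : Set (Literal A) :=
  ⋂₀ {M : Set (Literal A) | LitsClosed B M}

/-- A set of literals is consistent if it contains no atom together with its negation. -/
def ConsistentLits {A : Type} (M : Set (Literal A)) : Prop :=
  ∀ a : A, ¬ (Literal.pos a ∈ M ∧ Literal.neg a ∈ M)

/-- A rule base is consistent if its minimal model is consistent. -/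
def RBConsistent {A : Type} (B : Finset (Rule A)) : Prop :=
  ConsistentLits (minModel B)

/-- `MI B`: the minimal inconsistent subsets of `B`. -/
noncomputable def MI {A : Type} [DecidableEq A] (B : Finset (Rule A)) :
    Finset (Finset (Rule A)) :=
  B.powerset.filter fun M => ¬ RBConsistent M ∧ ∀ M' ∈ M.powerset, M' ≠ M → RBConsistent M'

/-- `F(B)`: the facts (rules with empty body) of a rule base. -/
noncomputable def factsOf {A : Type} (B : Finset (Rule A)) : Finset (Rule A) :=
  B.filter fun r => r.body = ∅

/-- `R(B)`: the non-fact rules of a rule base. -/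
noncomputable def rulesOf {A : Type} (B : Finset (Rule A)) : Finset (Rule A) :=
  B.filter fun r => r.body ≠ ∅

/-- The Σ-induced multi-rb culpability measure: a multiset of rule bases is given by a shared
rule set `R` and case-dependent fact sets `F i`, so that `Bᵢ = F i ∪ R`;
then `m^Σ_C(M, r) = Σᵢ C(Bᵢ, r)`. -/
noncomputable def mSigma {A : Type} [DecidableEq A] {n : ℕ}
    (C : Finset (Rule A) → Rule A → ENNReal)
    (R : Finset (Rule A)) (F : Fin n → Finset (Rule A)) (r : Rule A) : ENNReal :=
  ∑ i : Fin n, C (F i ∪ R) r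

/-- `V̂^{C^m}(M) = max_{r ∈ R(M)} C^m(M, r)` for the Σ-induced measure. -/
noncomputable def Vhat {A : Type} [DecidableEq A] {n : ℕ}
    (C : Finset (Rule A) → Rule A → ENNReal)
    (R : Finset (Rule A)) (F : Fin n → Finset (Rule A)) : ENNReal :=
  R.sup fun r => mSigma C R F r

/-- The atoms of the reduction: original atoms, one atom `kᵢ` per clause, and `s`. -/
abbrev SatAtom (A : Type) (n : ℕ) : Type := A ⊕ (Fin n ⊕ Unit)

/-- Lift a literal over `A` to a literal over the extended atom set. -/
def liftLit {A : Type} {n : ℕ} : Literal A → Literal (SatAtom A n)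
  | .pos a => .pos (Sum.inl a)
  | .neg a => .neg (Sum.inl a)

/-- The rule `r = k₁,...,kₙ → s`. -/
def satRule (A : Type) [DecidableEq A] (n : ℕ) : Rule (SatAtom A n) :=
  ⟨(Finset.univ : Finset (Fin n)).image fun i => Literal.pos (Sum.inr (Sum.inl i)),
    Literal.pos (Sum.inr (Sum.inr ()))⟩

/-- The rule base `B_I` of the reduction: facts `a, ¬a` for every atom `a ∈ A` and `¬s`,
rules `l_{i,j} → kᵢ` for every clause `i` and `j = 1,2,3`, and the rule `r`. -/
def BI {A : Type} [DecidableEq A] [Fintype A] {n : ℕ}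
    (c : Fin n → Fin 3 → Literal A) : Finset (Rule (SatAtom A n)) :=
  ((Finset.univ : Finset A).image fun a =>
      (⟨∅, Literal.pos (Sum.inl a)⟩ : Rule (SatAtom A n)))
    ∪ ((Finset.univ : Finset A).image fun a =>
      (⟨∅, Literal.neg (Sum.inl a)⟩ : Rule (SatAtom A n)))
    ∪ {(⟨∅, Literal.neg (Sum.inr (Sum.inr ()))⟩ : Rule (SatAtom A n))}
    ∪ ((Finset.univ : Finset (Fin n × Fin 3)).image fun p =>
      (⟨{liftLit (c p.1 p.2)}, Literal.pos (Sum.inr (Sum.inl p.1))⟩ : Rule (SatAtom A n)))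
    ∪ {satRule A n}

/-- A truth assignment satisfies a literal. -/
def LitSat {A : Type} (v : A → Bool) : Literal A → Prop
  | .pos a => v a = true
  | .neg a => v a = false

theorem litsClosed_minModel {A : Type} (B : Finset (Rule A)) : LitsClosed B (minModel B) := by
  intro r hr hb S hS
  exact hS r hr fun l hl => hb l hl S hS

theorem minModel_subset {A : Type} {B : Finset (Rule A)} {S : Set (Literal A)}
    (h : LitsClosed B S) : minModel B ⊆ S :=
  Set.sInter_subset_of_mem h

theorem RBConsistent.of_litsClosed {A : Type} {B : Finset (Rule A)} {S : Set (Literal A)}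
    (h : LitsClosed B S) (hS : ConsistentLits S) : RBConsistent B :=
  fun a ha => hS a ⟨minModel_subset h ha.1, minModel_subset h ha.2⟩

theorem minModel_mono {A : Type} {B C : Finset (Rule A)} (h : B ⊆ C) :
    minModel B ⊆ minModel C :=
  minModel_subset fun r hr => litsClosed_minModel C r (h hr)

/-- Every literal of the minimal model is the head of a rule whose body lies in the model. -/
theorem exists_rule_of_mem_minModel {A : Type} {B : Finset (Rule A)} {l : Literal A}
    (hl : l ∈ minModel B) : ∃ r ∈ B, r.head = l ∧ ∀ x ∈ r.body, x ∈ minModel B := by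
  let S : Set (Literal A) := {l | ∃ r ∈ B, r.head = l ∧ ∀ x ∈ r.body, x ∈ minModel B}
  have hS : S ⊆ minModel B := by
    rintro _ ⟨r, hr, rfl, hb⟩
    exact litsClosed_minModel B r hr hb
  exact minModel_subset (S := S) (fun r hr hb => ⟨r, hr, rfl, fun x hx => hS (hb x hx)⟩) hl

theorem mem_MI {A : Type} [DecidableEq A] {B M : Finset (Rule A)} :
    M ∈ MI B ↔ M ⊆ B ∧ ¬ RBConsistent M ∧ ∀ M' ⊆ M, M' ≠ M → RBConsistent M' := by
  simp [MI]

theorem exists_subset_mem_MI {A : Type} [DecidableEq A] {B C : Finset (Rule A)} (hCB : C ⊆ B)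
    (hC : ¬ RBConsistent C) : ∃ M ∈ MI B, M ⊆ C := by
  obtain ⟨M, hMC, hM⟩ :=
    exists_minimal_le_of_wellFoundedLT (fun D : Finset (Rule A) => ¬ RBConsistent D) C hC
  refine ⟨M, mem_MI.2 ⟨hMC.trans hCB, hM.prop, fun M' hM' hne => ?_⟩, hMC⟩
  by_contra hcon
  exact hne (hM'.antisymm (hM.le_of_le hcon hM'))

/-- In a minimal inconsistent set every rule fires. -/
theorem body_subset_minModel_of_mem_MI {A : Type} [DecidableEq A] {B M : Finset (Rule A)}
    (hM : M ∈ MI B) {r : Rule A} (hr : r ∈ M) : ∀ l ∈ r.body, l ∈ minModel M := by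
  obtain ⟨-, hinc, hmin⟩ := mem_MI.1 hM
  by_contra hb
  have hcon : RBConsistent (M.erase r) :=
    hmin _ (Finset.erase_subset _ _) fun h => Finset.erase_eq_self.1 h hr
  refine hinc (.of_litsClosed (S := minModel (M.erase r)) (fun q hq hqb => ?_) hcon)
  rcases eq_or_ne q r with rfl | hne
  · exact absurd (fun l hl => minModel_mono (Finset.erase_subset _ _) (hqb l hl)) hb
  · exact litsClosed_minModel _ q (Finset.mem_erase.2 ⟨hne, hq⟩) hqb

theorem not_RBConsistent_of_facts {A : Type} {B : Finset (Rule A)} {a : A}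
    (hp : (⟨∅, .pos a⟩ : Rule A) ∈ B) (hn : (⟨∅, .neg a⟩ : Rule A) ∈ B) : ¬ RBConsistent B :=
  fun h => h a ⟨litsClosed_minModel B _ hp (by simp), litsClosed_minModel B _ hn (by simp)⟩

theorem mem_BI {A : Type} [DecidableEq A] [Fintype A] {n : ℕ} {c : Fin n → Fin 3 → Literal A}
    {q : Rule (SatAtom A n)} :
    q ∈ BI c ↔ (∃ l : Literal A, q = ⟨∅, liftLit l⟩) ∨ q = ⟨∅, .neg (.inr (.inr ()))⟩ ∨
      (∃ i j, q = ⟨{liftLit (c i j)}, .pos (.inr (.inl i))⟩) ∨ q = satRule A n := by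
  simp only [BI, Finset.mem_union, Finset.mem_image, Finset.mem_univ, true_and,
    Finset.mem_singleton, Prod.exists]
  constructor
  · rintro ((((⟨a, rfl⟩ | ⟨a, rfl⟩) | h) | ⟨i, j, rfl⟩) | h)
    · exact .inl ⟨.pos a, rfl⟩
    · exact .inl ⟨.neg a, rfl⟩
    · exact .inr (.inl h)
    · exact .inr (.inr (.inl ⟨i, j, rfl⟩))
    · exact .inr (.inr (.inr h))
  · rintro (⟨a | a, rfl⟩ | h | ⟨i, j, rfl⟩ | h)
    · exact .inl (.inl (.inl (.inl ⟨a, rfl⟩)))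
    · exact .inl (.inl (.inl (.inr ⟨a, rfl⟩)))
    · exact .inl (.inl (.inr h))
    · exact .inl (.inr ⟨i, j, rfl⟩)
    · exact .inr h

/-- The literals true under `v`, all clause atoms, and `¬s`. -/
def assignmentLits {A : Type} (n : ℕ) (v : A → Bool) : Set (Literal (SatAtom A n)) :=
  {x | (∃ l, LitSat v l ∧ x = liftLit l) ∨ (∃ i, x = .pos (.inr (.inl i))) ∨
    x = .neg (.inr (.inr ()))}

theorem consistentLits_assignmentLits {A : Type} (n : ℕ) (v : A → Bool) :
    ConsistentLits (assignmentLits n v) := by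
  rintro a ⟨⟨l, hl, h⟩ | ⟨i, h⟩ | h, ⟨l', hl', h'⟩ | ⟨i', h'⟩ | h'⟩ <;>
    (try cases l) <;> (try cases l') <;> simp_all [liftLit, LitSat]

theorem exists_mem_MI_of_sat {A : Type} [DecidableEq A] [Fintype A] {n : ℕ}
    {c : Fin n → Fin 3 → Literal A} {v : A → Bool} (hv : ∀ i, ∃ j, LitSat v (c i j)) :
    ∃ M ∈ MI (BI c), satRule A n ∈ M := by
  let C := (BI c).filter fun q => q = satRule A n ∨ q.head ∈ assignmentLits n v
  have hr : satRule A n ∈ C := by simp [C, mem_BI]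
  have hC : ¬ RBConsistent C := by
    have hk (i : Fin n) : Literal.pos (.inr (.inl i)) ∈ minModel C := by
      obtain ⟨j, hj⟩ := hv i
      refine litsClosed_minModel C ⟨{liftLit (c i j)}, _⟩
        (Finset.mem_filter.2 ⟨mem_BI.2 (.inr (.inr (.inl ⟨i, j, rfl⟩))),
          .inr (.inr (.inl ⟨i, rfl⟩))⟩) fun l hl => ?_
      rw [Finset.mem_singleton.1 hl]
      exact litsClosed_minModel C ⟨∅, liftLit (c i j)⟩
        (Finset.mem_filter.2 ⟨mem_BI.2 (.inl ⟨_, rfl⟩), .inr (.inl ⟨_, hj, rfl⟩)⟩) (by simp)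
    refine fun h => h (.inr (.inr ())) ⟨litsClosed_minModel C _ hr fun l hl => ?_,
      litsClosed_minModel C ⟨∅, _⟩ (Finset.mem_filter.2 ⟨mem_BI.2 (.inr (.inl rfl)),
        .inr (.inr (.inr rfl))⟩) (by simp)⟩
    obtain ⟨i, -, rfl⟩ := Finset.mem_image.1 hl
    exact hk i
  obtain ⟨M, hM, hMC⟩ := exists_subset_mem_MI (Finset.filter_subset _ _) hC
  refine ⟨M, hM, ?_⟩
  by_contra hrM
  refine (mem_MI.1 hM).2.1
    (.of_litsClosed (fun q hq _ => ?_) (consistentLits_assignmentLits n v))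
  exact (Finset.mem_filter.1 (hMC hq)).2.resolve_left (by rintro rfl; exact hrM hq)

theorem exists_sat_of_mem_MI {A : Type} [DecidableEq A] [Fintype A] {n : ℕ}
    {c : Fin n → Fin 3 → Literal A} {M : Finset (Rule (SatAtom A n))} (hM : M ∈ MI (BI c))
    (hr : satRule A n ∈ M) : ∃ v : A → Bool, ∀ i, ∃ j, LitSat v (c i j) := by
  obtain ⟨hMB, -, hmin⟩ := mem_MI.1 hM
  have hfacts (a : A) (hp : (⟨∅, .pos (.inl a)⟩ : Rule (SatAtom A n)) ∈ M)
      (hn : (⟨∅, .neg (.inl a)⟩ : Rule (SatAtom A n)) ∈ M) : False := by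
    refine not_RBConsistent_of_facts (B := M.erase (satRule A n)) (a := .inl a) ?_ ?_
      (hmin _ (Finset.erase_subset _ _) fun h => Finset.erase_eq_self.1 h hr) <;>
    simp [hp, hn, satRule]
  refine ⟨fun a => decide ((⟨∅, .pos (.inl a)⟩ : Rule (SatAtom A n)) ∈ M), fun i => ?_⟩
  have hk : Literal.pos (.inr (.inl i)) ∈ minModel M :=
    body_subset_minModel_of_mem_MI hM hr _ (Finset.mem_image_of_mem _ (Finset.mem_univ i))
  obtain ⟨q, hq, hhead, hbody⟩ := exists_rule_of_mem_minModel hk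
  obtain ⟨j, hj⟩ : ∃ j, liftLit (c i j) ∈ minModel M := by
    rcases mem_BI.1 (hMB hq) with ⟨l, rfl⟩ | rfl | ⟨i', j, rfl⟩ | rfl
    · cases l <;> simp [liftLit] at hhead
    · simp at hhead
    · obtain rfl : i' = i := by simpa using hhead
      exact ⟨j, hbody _ (Finset.mem_singleton_self _)⟩
    · simp [satRule] at hhead
  obtain ⟨p, hp, hphead, -⟩ := exists_rule_of_mem_minModel hj
  have hpM : (⟨∅, liftLit (c i j)⟩ : Rule (SatAtom A n)) ∈ M := by
    rcases mem_BI.1 (hMB hp) with ⟨l, rfl⟩ | rfl | ⟨i', j', rfl⟩ | rfl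
    · exact hphead ▸ hp
    all_goals cases hc : c i j <;> simp [hc, liftLit, satRule] at hphead
  refine ⟨j, ?_⟩
  cases hc : c i j with
  | pos a => simpa [LitSat, hc, liftLit] using hpM
  | neg a =>
    rw [hc] at hpM
    simpa [LitSat] using fun h => hfacts a h hpM

/-- the 3SAT instance `{c₁,...,cₙ}` is satisfiable iff there is a minimal
inconsistent subset of `B_I` containing the rule `r = k₁,...,kₙ → s`. -/
theorem threeSat_iff_rule_in_MI {A : Type} [DecidableEq A] [Fintype A] (n : ℕ)
    (c : Fin n → Fin 3 → Literal A) :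
    (∃ v : A → Bool, ∀ i : Fin n, ∃ j : Fin 3, LitSat v (c i j)) ↔
      ∃ M ∈ MI (BI c), satRule A n ∈ M := by
  exact ⟨fun ⟨_, hv⟩ => exists_mem_MI_of_sat hv, fun ⟨_, hM, hr⟩ => exists_sat_of_mem_MI hM hr⟩
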